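/- For every c > 0 there exists a unique real E such that −c < E < 0, −c − E > −ã₁, and u'(−c−E)·v'(−E) = v'(−c−E)·u'(−E). Moreover this E (the rescaled bottom E⁰_min of the spectrum of the periodic Airy–Schrödinger operator) satisfies −c < E < min(−c/2, −c + ã₁). -/

import Mathlib

open Real Set

/-- Derivative of the standard Airy function `Ai` expressed in the basis of the
canonical solutions `u`, `v` of the Airy equation (given their derivatives `u'`, `v'`):
`Ai'(x) = u'(x)/(3^(2/3)·Γ(2/3)) − v'(x)/(3^(1/3)·Γ(1/3))`. -/
noncomputable def AiD (u' v' : ℝ → ℝ) (x : ℝ) : ℝ :=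
  u' x / ((3:ℝ) ^ ((2:ℝ)/3) * Real.Gamma (2/3))
    - v' x / ((3:ℝ) ^ ((1:ℝ)/3) * Real.Gamma (1/3))

/-- A continuous function without zeros between `a` and `b` keeps its sign. -/
theorem Continuous.pos_of_forall_uIcc_ne_zero {f : ℝ → ℝ} (hf : Continuous f) {a b : ℝ}
    (ha : 0 < f a) (h : ∀ x ∈ uIcc a b, f x ≠ 0) : 0 < f b := by
  by_contra! hb
  obtain ⟨x, hx, hx0⟩ := intermediate_value_uIcc (hf.continuousOn (s := uIcc a b))
    (mem_uIcc.2 (Or.inr ⟨hb, ha.le⟩))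
  exact h x hx hx0

/-- The Wronskian of the canonical solutions of the Airy equation is `1`. -/
theorem airy_wronskian {u v u' v' : ℝ → ℝ}
    (hu : ∀ x, HasDerivAt u (u' x) x) (huAiry : ∀ x, HasDerivAt u' (x * u x) x)
    (hv : ∀ x, HasDerivAt v (v' x) x) (hvAiry : ∀ x, HasDerivAt v' (x * v x) x)
    (hu0 : u 0 = 1) (hu'0 : u' 0 = 0) (hv'0 : v' 0 = 1) (x : ℝ) :
    u x * v' x - u' x * v x = 1 := by
  have hd (y : ℝ) : HasDerivAt (fun y => u y * v' y - u' y * v y) 0 y :=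
    (((hu y).mul (hvAiry y)).sub ((huAiry y).mul (hv y))).congr_deriv (by ring)
  have := is_const_of_deriv_eq_zero (fun y => (hd y).differentiableAt) (fun y => (hd y).deriv) x 0
  simpa [hu0, hu'0, hv'0] using this

/-- The derivative of the odd-type Airy solution is at least `1` on the positive half-line. -/
theorem airy_one_le_deriv {v v' : ℝ → ℝ}
    (hv : ∀ x, HasDerivAt v (v' x) x) (hvAiry : ∀ x, HasDerivAt v' (x * v x) x)
    (hv0 : v 0 = 0) (hv'0 : v' 0 = 1) {x : ℝ} (hx : 0 ≤ x) : 1 ≤ v' x := by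
  have hprod : MonotoneOn (fun y => v y * v' y) (Ici 0) := by
    have hd (y : ℝ) := (hv y).mul (hvAiry y)
    refine monotoneOn_of_hasDerivWithinAt_nonneg (convex_Ici 0)
      (fun y _ => (hd y).continuousAt.continuousWithinAt)
      (fun y _ => (hd y).hasDerivWithinAt) (fun y hy => ?_)
    rw [interior_Ici, mem_Ioi] at hy
    nlinarith [mul_self_nonneg (v' y), mul_nonneg hy.le (mul_self_nonneg (v y))]
  have hsq : MonotoneOn (fun y => v' y * v' y) (Ici 0) := by
    have hd (y : ℝ) := (hvAiry y).mul (hvAiry y)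
    refine monotoneOn_of_hasDerivWithinAt_nonneg (convex_Ici 0)
      (fun y _ => (hd y).continuousAt.continuousWithinAt)
      (fun y _ => (hd y).hasDerivWithinAt) (fun y hy => ?_)
    rw [interior_Ici, mem_Ioi] at hy
    have h : v 0 * v' 0 ≤ v y * v' y := hprod self_mem_Ici hy.le hy.le
    rw [hv0, zero_mul] at h
    nlinarith [mul_nonneg hy.le h]
  have hsq' {y : ℝ} (hy : 0 ≤ y) : 1 ≤ v' y * v' y := by
    have h : v' 0 * v' 0 ≤ v' y * v' y := hsq self_mem_Ici hy hy
    simpa [hv'0] using h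
  have hpos : 0 < v' x := by
    have hc : Continuous v' := continuous_iff_continuousAt.2 fun y => (hvAiry y).continuousAt
    refine hc.pos_of_forall_uIcc_ne_zero (a := 0) (by rw [hv'0]; exact one_pos) fun y hy h0 => ?_
    rw [uIcc_of_le hx] at hy
    have := hsq' hy.1
    rw [h0] at this
    norm_num at this
  nlinarith [hsq' hx]

/-- If `u' ≤ r v'` on `[-t, ∞)`, then `v'` is positive there. -/
theorem airy_deriv_pos {u v u' v' : ℝ → ℝ}
    (hv : ∀ x, HasDerivAt v (v' x) x) (hvAiry : ∀ x, HasDerivAt v' (x * v x) x)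
    (hv0 : v 0 = 0) (hv'0 : v' 0 = 1)
    (hW : ∀ x, u x * v' x - u' x * v x = 1) {r t : ℝ}
    (hle : ∀ x, -t ≤ x → u' x ≤ r * v' x) {x : ℝ} (hx : -t ≤ x) : 0 < v' x := by
  rcases le_total 0 x with hx0 | hx0
  · exact one_pos.trans_le (airy_one_le_deriv hv hvAiry hv0 hv'0 hx0)
  have hc : Continuous v' := continuous_iff_continuousAt.2 fun y => (hvAiry y).continuousAt
  by_contra! hneg
  have hne : (Icc x 0 ∩ v' ⁻¹' {0}).Nonempty := by
    obtain ⟨z, hz, hz0⟩ := intermediate_value_Icc hx0 hc.continuousOn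
      (show (0 : ℝ) ∈ Icc (v' x) (v' 0) from ⟨hneg, by rw [hv'0]; exact zero_le_one⟩)
    exact ⟨z, hz, hz0⟩
  obtain ⟨z, ⟨⟨hxz, hz0⟩, hzz⟩, hzmax⟩ :=
    (isCompact_Icc.inter_right (isClosed_singleton.preimage hc)).exists_isGreatest hne
  rw [mem_preimage, mem_singleton_iff] at hzz
  have hzlt : z < 0 := lt_of_le_of_ne hz0 (by rintro rfl; rw [hv'0] at hzz; norm_num at hzz)
  have hmono : StrictMonoOn v (Icc z 0) := by
    refine strictMonoOn_of_hasDerivWithinAt_pos (convex_Icc z 0)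
      (fun y _ => (hv y).continuousAt.continuousWithinAt)
      (fun y _ => (hv y).hasDerivWithinAt) (fun y hy => ?_)
    rw [interior_Icc] at hy
    refine hc.pos_of_forall_uIcc_ne_zero (a := 0) (by rw [hv'0]; exact one_pos) fun w hw hw0 => ?_
    rw [uIcc_of_ge hy.2.le] at hw
    exact absurd (hzmax ⟨⟨by linarith [hw.1, hy.1], hw.2⟩, hw0⟩) (by linarith [hw.1, hy.1])
  have hvz : v z < v 0 := hmono (left_mem_Icc.2 hz0) (right_mem_Icc.2 hz0) hzlt
  have hu'z := hle z (hx.trans hxz)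
  have hWz := hW z
  rw [hzz] at hu'z hWz
  nlinarith [mul_nonneg_of_nonpos_of_nonpos (show u' z ≤ 0 by linarith)
    (show v z ≤ 0 by linarith)]

/-- The derivative of the odd-type Airy solution exceeds `1` on the positive half-line. -/
theorem airy_one_lt_deriv {v v' : ℝ → ℝ}
    (hv : ∀ x, HasDerivAt v (v' x) x) (hvAiry : ∀ x, HasDerivAt v' (x * v x) x)
    (hv0 : v 0 = 0) (hv'0 : v' 0 = 1) {x : ℝ} (hx : 0 < x) : 1 < v' x := by
  have hmono : StrictMonoOn v (Ici 0) := by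
    refine strictMonoOn_of_hasDerivWithinAt_pos (convex_Ici 0)
      (fun y _ => (hv y).continuousAt.continuousWithinAt)
      (fun y _ => (hv y).hasDerivWithinAt) (fun y hy => ?_)
    rw [interior_Ici, mem_Ioi] at hy
    exact one_pos.trans_le (airy_one_le_deriv hv hvAiry hv0 hv'0 hy.le)
  have hmono' : StrictMonoOn v' (Ici 0) := by
    refine strictMonoOn_of_hasDerivWithinAt_pos (convex_Ici 0)
      (fun y _ => (hvAiry y).continuousAt.continuousWithinAt)
      (fun y _ => (hvAiry y).hasDerivWithinAt) (fun y hy => ?_)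
    rw [interior_Ici, mem_Ioi] at hy
    have h : v 0 < v y := hmono self_mem_Ici hy.le hy
    exact mul_pos hy (hv0 ▸ h)
  exact hv'0 ▸ hmono' self_mem_Ici hx.le hx

/-- Where it stays positive to the left of `0`, the derivative of the odd-type Airy solution is
less than `1`. -/
theorem airy_deriv_lt_one {v v' : ℝ → ℝ}
    (hv : ∀ x, HasDerivAt v (v' x) x) (hvAiry : ∀ x, HasDerivAt v' (x * v x) x)
    (hv0 : v 0 = 0) (hv'0 : v' 0 = 1) {t : ℝ} (hpos : ∀ x, -t ≤ x → 0 < v' x)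
    {x : ℝ} (hx : -t ≤ x) (hx0 : x < 0) : v' x < 1 := by
  have hmono : StrictMonoOn v (Icc x 0) := by
    refine strictMonoOn_of_hasDerivWithinAt_pos (convex_Icc x 0)
      (fun y _ => (hv y).continuousAt.continuousWithinAt)
      (fun y _ => (hv y).hasDerivWithinAt) (fun y hy => ?_)
    rw [interior_Icc] at hy
    exact hpos y (hx.trans hy.1.le)
  have hmono' : StrictMonoOn v' (Icc x 0) := by
    refine strictMonoOn_of_hasDerivWithinAt_pos (convex_Icc x 0)
      (fun y _ => (hvAiry y).continuousAt.continuousWithinAt)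
      (fun y _ => (hvAiry y).hasDerivWithinAt) (fun y hy => ?_)
    rw [interior_Icc] at hy
    have h : v y < v 0 := hmono (Ioo_subset_Icc_self hy) (right_mem_Icc.2 hx0.le) hy.2
    exact mul_pos_of_neg_of_neg hy.2 (hv0 ▸ h)
  exact hv'0 ▸ hmono' (left_mem_Icc.2 hx0.le) (right_mem_Icc.2 hx0.le) hx0

theorem stmt_6 (u v u' v' : ℝ → ℝ)
    (hu : ∀ x, HasDerivAt u (u' x) x)
    (huAiry : ∀ x, HasDerivAt u' (x * u x) x)
    (hv : ∀ x, HasDerivAt v (v' x) x)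
    (hvAiry : ∀ x, HasDerivAt v' (x * v x) x)
    (hu0 : u 0 = 1) (hu'0 : u' 0 = 0) (hv0 : v 0 = 0) (hv'0 : v' 0 = 1)
    (ta1 : ℝ) (hta1pos : 0 < ta1)
    (hta1z : AiD u' v' (-ta1) = 0)
    (hta1ne : ∀ x : ℝ, -ta1 < x → AiD u' v' x ≠ 0) :
    ∀ c : ℝ, 0 < c →
      (∃! E : ℝ, -c < E ∧ E < 0 ∧ -ta1 < -c - E ∧
        u' (-c - E) * v' (-E) = v' (-c - E) * u' (-E)) ∧
      (∀ E : ℝ, (-c < E ∧ E < 0 ∧ -ta1 < -c - E ∧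
          u' (-c - E) * v' (-E) = v' (-c - E) * u' (-E)) →
        E < min (-c/2) (-c + ta1)) := by
  have hA : 0 < (3:ℝ) ^ ((2:ℝ)/3) * Real.Gamma (2/3) :=
    mul_pos (by positivity) (Real.Gamma_pos_of_pos (by norm_num))
  have hB : 0 < (3:ℝ) ^ ((1:ℝ)/3) * Real.Gamma (1/3) :=
    mul_pos (by positivity) (Real.Gamma_pos_of_pos (by norm_num))
  unfold AiD at hta1z hta1ne
  set A := (3:ℝ) ^ ((2:ℝ)/3) * Real.Gamma (2/3)
  set B := (3:ℝ) ^ ((1:ℝ)/3) * Real.Gamma (1/3)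
  have hcu : Continuous u' := continuous_iff_continuousAt.2 fun y => (huAiry y).continuousAt
  have hcv : Continuous v' := continuous_iff_continuousAt.2 fun y => (hvAiry y).continuousAt
  have hW := airy_wronskian hu huAiry hv hvAiry hu0 hu'0 hv'0
  have heq : u' (-ta1) = A / B * v' (-ta1) := by
    field_simp at hta1z ⊢
    linarith
  have hlt {x : ℝ} (hx : -ta1 < x) : u' x < A / B * v' x := by
    have hc : Continuous fun y => v' y / B - u' y / A := by fun_prop
    have h : 0 < v' x / B - u' x / A := by
      refine hc.pos_of_forall_uIcc_ne_zero (a := 0) (by simpa [hu'0, hv'0] using hB)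
        fun y hy h0 => hta1ne y ?_ (by linarith)
      exact (lt_min (by linarith) hx).trans_le hy.1
    calc u' x = A * (u' x / A) := by field_simp
      _ < A * (v' x / B) := mul_lt_mul_of_pos_left (sub_pos.1 h) hA
      _ = A / B * v' x := by ring
  have hpos (x : ℝ) (hx : -ta1 ≤ x) : 0 < v' x := by
    refine airy_deriv_pos hv hvAiry hv0 hv'0 hW (r := A / B) (fun y hy => ?_) hx
    rcases hy.eq_or_lt with rfl | hy
    · exact heq.le
    · exact (hlt hy).le
  let R : ℝ → ℝ := fun x => u' x / v' x
  have hR (x : ℝ) (hx : -ta1 ≤ x) : HasDerivAt R (x / v' x ^ 2) x :=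
    ((huAiry x).div (hvAiry x) (hpos x hx).ne').congr_deriv (by
      congr 1
      linear_combination x * hW x)
  have hR0 : R 0 = 0 := by simp [R, hu'0]
  have hRmono : StrictMonoOn R (Ici 0) := by
    refine strictMonoOn_of_hasDerivWithinAt_pos (convex_Ici 0)
      (fun y hy => (hR y (by linarith [mem_Ici.1 hy])).continuousAt.continuousWithinAt)
      (fun y hy => (hR y ?_).hasDerivWithinAt) (fun y hy => ?_)
    all_goals rw [interior_Ici, mem_Ioi] at hy
    · linarith
    · have := hpos y (by linarith)
      positivity
  have hRanti : StrictAntiOn R (Icc (-ta1) 0) := by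
    refine strictAntiOn_of_hasDerivWithinAt_neg (convex_Icc _ _)
      (fun y hy => (hR y hy.1).continuousAt.continuousWithinAt)
      (fun y hy => (hR y ?_).hasDerivWithinAt) (fun y hy => ?_)
    all_goals rw [interior_Icc] at hy
    · exact hy.1.le
    · have := hpos y hy.1.le
      exact div_neg_of_neg_of_pos hy.2 (by positivity)
  have hRrefl {t : ℝ} (ht : 0 < t) (ht1 : t ≤ ta1) : R t < R (-t) := by
    have hd (s : ℝ) (hs : s ∈ Icc 0 ta1) :
        HasDerivAt (fun s => R (-s) - R s) (s / v' (-s) ^ 2 - s / v' s ^ 2) s :=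
      (((hR (-s) (by linarith [hs.2])).comp s (hasDerivAt_neg s)).sub
        (hR s (by linarith [hs.1]))).congr_deriv (by ring)
    have hm : StrictMonoOn (fun s => R (-s) - R s) (Icc 0 ta1) := by
      refine strictMonoOn_of_hasDerivWithinAt_pos (convex_Icc _ _)
        (fun y hy => (hd y hy).continuousAt.continuousWithinAt)
        (fun y hy => (hd y (interior_subset hy)).hasDerivWithinAt) (fun y hy => ?_)
      rw [interior_Icc] at hy
      have h1 := airy_one_lt_deriv hv hvAiry hv0 hv'0 hy.1
      have h2 := airy_deriv_lt_one hv hvAiry hv0 hv'0 hpos (x := -y) (by linarith [hy.2])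
        (by linarith [hy.1])
      have h3 := hpos (-y) (by linarith [hy.2])
      have h4 : v' (-y) ^ 2 < v' y ^ 2 := by gcongr; linarith
      have := div_lt_div_of_pos_left hy.1 (by positivity) h4
      linarith
    have h : R (-0) - R 0 < R (-t) - R t := hm ⟨le_rfl, hta1pos.le⟩ ⟨ht.le, ht1⟩ ht
    rw [neg_zero, sub_self] at h
    linarith
  have hiff {a b : ℝ} (ha : -ta1 ≤ a) (hb : 0 ≤ b) :
      u' a * v' b = v' a * u' b ↔ R a = R b := by
    have h1 := hpos a ha
    have h2 := hpos b (by linarith)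
    rw [div_eq_div_iff h1.ne' h2.ne', mul_comm (v' a)]
  intro c hc
  have hunique {E F : ℝ} (hE : -c < E) (hF0 : F < 0) (hF : -ta1 < -c - F)
      (hER : R (-c - E) = R (-E)) (hFR : R (-c - F) = R (-F)) : ¬ E < F := by
    intro h
    have h1 := hRanti (a := -c - F) (b := -c - E) ⟨hF.le, by linarith⟩
      ⟨by linarith, by linarith⟩ (by linarith)
    have h2 := hRmono (a := -F) (b := -E) (mem_Ici.2 (by linarith)) (mem_Ici.2 (by linarith))
      (by linarith)
    linarith
  refine ⟨existsUnique_of_exists_of_unique ?_ ?_, ?_⟩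
  · have hg : Continuous fun a => u' a * v' (a + c) - v' a * u' (a + c) := by fun_prop
    have hm0 : -min ta1 c < 0 := neg_lt_zero.2 (lt_min hta1pos hc)
    have hgl : 0 < u' (-min ta1 c) * v' (-min ta1 c + c) -
        v' (-min ta1 c) * u' (-min ta1 c + c) := by
      rcases lt_or_ge ta1 c with h | h
      · rw [min_eq_left h.le, heq]
        nlinarith [mul_pos (hpos (-ta1) le_rfl) (sub_pos.2 (hlt (x := -ta1 + c) (by linarith)))]
      · rw [min_eq_right h, neg_add_cancel, hu'0, hv'0, mul_one, mul_zero, sub_zero]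
        have h1 := hRanti (a := -c) (b := 0) ⟨by linarith, by linarith⟩
          ⟨by linarith, le_rfl⟩ (by linarith)
        rw [hR0] at h1
        exact (div_pos_iff_of_pos_right (hpos (-c) (by linarith))).1 h1
    have hgr : u' 0 * v' (0 + c) - v' 0 * u' (0 + c) < 0 := by
      have h1 := hRmono self_mem_Ici (mem_Ici.2 hc.le) hc
      rw [hR0] at h1
      have := (div_pos_iff_of_pos_right (hpos c (by linarith))).1 h1
      rw [hu'0, hv'0, zero_add]
      linarith
    obtain ⟨a, ⟨ha, ha0⟩, hga⟩ :=
      intermediate_value_Ioo' hm0.le hg.continuousOn ⟨hgr, hgl⟩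
    have ha1 := min_le_left ta1 c
    have ha2 := min_le_right ta1 c
    refine ⟨-c - a, by linarith, by linarith, by linarith, ?_⟩
    have e1 : -c - (-c - a) = a := by ring
    have e2 : -(-c - a) = a + c := by ring
    rw [e1, e2]
    exact sub_eq_zero.1 hga
  · rintro E F ⟨hE, hE0, hE1, hE2⟩ ⟨hF, hF0, hF1, hF2⟩
    rw [hiff hE1.le (by linarith)] at hE2
    rw [hiff hF1.le (by linarith)] at hF2
    exact le_antisymm (not_lt.1 (hunique hF hE0 hE1 hF2 hE2))
      (not_lt.1 (hunique hE hF0 hF1 hE2 hF2))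
  · rintro E ⟨hE, hE0, hE1, hE2⟩
    rw [hiff hE1.le (by linarith)] at hE2
    have h := hRrefl (t := c + E) (by linarith) (by linarith)
    rw [neg_add', hE2] at h
    have := (hRmono.lt_iff_lt (mem_Ici.2 (by linarith)) (mem_Ici.2 (by linarith))).1 h
    exact lt_min (by linarith) (by linarith)
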